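/- Sequential individual-global-max (IGM) principle: a joint action a* = (a₁*, …, aₙ*) maximizes Q over A₁ × ⋯ × Aₙ if and only if for every k ∈ {1, …, n}, the action aₖ* maximizes the map aₖ ↦ Āₖ(a*_{1:k-1}, aₖ) over Aₖ. In particular, sequentially choosing a₁* ∈ argmax_{a₁} Ā₁(a₁), then a₂* ∈ argmax_{a₂} Ā₂(a₁*, a₂), and so on up to aₙ* ∈ argmax_{aₙ} Āₙ(a*_{1:n-1}, aₙ), always produces a global maximizer of Q. -/

import Mathlib

/-- The greedy value function `Q̄ₖ(a_{1:k})`: the maximum of `Q` over all joint actions whose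
first `k` coordinates agree with `a`. -/
noncomputable def Qbar {n : ℕ} {A : Fin n → Type*} [∀ i, Fintype (A i)] [∀ i, Nonempty (A i)]
    (Q : (∀ i, A i) → ℝ) (k : ℕ) (a : ∀ i, A i) : ℝ :=
  Finset.univ.sup' Finset.univ_nonempty
    (fun b : ∀ i, A i => Q (fun i => if (i : ℕ) < k then a i else b i))

theorem le_Qbar {n : ℕ} {A : Fin n → Type*} [∀ i, Fintype (A i)] [∀ i, Nonempty (A i)]
    (Q : (∀ i, A i) → ℝ) {k : ℕ} {a b : ∀ i, A i} (h : ∀ i : Fin n, (i : ℕ) < k → b i = a i) :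
    Q b ≤ Qbar Q k a := by
  have hb : (fun i : Fin n => if (i : ℕ) < k then a i else b i) = b := by
    funext i
    split_ifs with hi
    · exact (h i hi).symm
    · rfl
  have hle := Finset.le_sup' (fun b : ∀ i, A i => Q (fun i => if (i : ℕ) < k then a i else b i))
    (Finset.mem_univ b)
  rwa [hb] at hle

theorem exists_Qbar_eq {n : ℕ} {A : Fin n → Type*} [∀ i, Fintype (A i)] [∀ i, Nonempty (A i)]
    (Q : (∀ i, A i) → ℝ) (k : ℕ) (a : ∀ i, A i) :
    ∃ c : ∀ i, A i, (∀ i : Fin n, (i : ℕ) < k → c i = a i) ∧ Qbar Q k a = Q c := by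
  obtain ⟨b, -, hb⟩ := Finset.exists_mem_eq_sup' Finset.univ_nonempty
    (fun b : ∀ i, A i => Q (fun i => if (i : ℕ) < k then a i else b i))
  exact ⟨_, fun i hi => if_pos hi, hb⟩

theorem exists_Qbar_le_Qbar_succ_update {n : ℕ} {A : Fin n → Type*} [∀ i, Fintype (A i)]
    [∀ i, Nonempty (A i)] (Q : (∀ i, A i) → ℝ) (k : Fin n) (a : ∀ i, A i) :
    ∃ x : A k, Qbar Q k.val a ≤ Qbar Q (k.val + 1) (Function.update a k x) := by
  obtain ⟨c, hca, hc⟩ := exists_Qbar_eq Q k.val a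
  refine ⟨c k, hc.trans_le (le_Qbar Q fun i hi => ?_)⟩
  rcases eq_or_ne i k with rfl | hik
  · simp
  · rw [Function.update_of_ne hik]
    exact hca i (lt_of_le_of_ne (Nat.le_of_lt_succ hi) (Fin.val_ne_of_ne hik))

/-- Sequential individual-global-max (IGM) principle: a joint action `a` maximizes `Q` over
the product action space if and only if for every agent `k`, the action `a k` maximizes the
greedy advantage `x ↦ Āₖ(a_{1:k-1}, x) = Q̄ₖ(a_{1:k-1}, x) − Q̄ₖ₋₁(a_{1:k-1})`.
(Agent `k : Fin n` is 0-indexed, corresponding to agent `k+1` in 1-indexed notation;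
`Q̄ₖ(a_{1:k-1}, x)` is encoded as `Qbar Q (k+1) (Function.update a k x)`, which depends only on
the first `k` coordinates of `a` and on `x`.) -/
theorem seq_IGM {n : ℕ} (hn : 1 ≤ n)
    {A : Fin n → Type*} [∀ i, Fintype (A i)] [∀ i, Nonempty (A i)]
    (Q : (∀ i, A i) → ℝ) (a : ∀ i, A i) :
    (∀ b : ∀ i, A i, Q b ≤ Q a) ↔
      ∀ (k : Fin n) (x : A k),
        Qbar Q (k.val + 1) (Function.update a k x) - Qbar Q k.val a ≤
          Qbar Q (k.val + 1) a - Qbar Q k.val a := by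
  constructor
  · intro h k x
    obtain ⟨c, -, hc⟩ := exists_Qbar_eq Q (k.val + 1) (Function.update a k x)
    rw [hc]
    exact sub_le_sub_right ((h c).trans (le_Qbar Q fun _ _ => rfl)) _
  · intro h b
    have mono : ∀ m ≤ n, Qbar Q 0 a ≤ Qbar Q m a := by
      intro m
      induction m with
      | zero => exact fun _ => le_rfl
      | succ m ih =>
        intro hm
        obtain ⟨x, hx⟩ := exists_Qbar_le_Qbar_succ_update Q ⟨m, hm⟩ a
        exact (ih (Nat.le_of_succ_le hm)).trans
          (hx.trans ((sub_le_sub_iff_right _).1 (h ⟨m, hm⟩ x)))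
    obtain ⟨c, hca, hc⟩ := exists_Qbar_eq Q n a
    obtain rfl : c = a := funext fun i => hca i i.isLt
    exact (le_Qbar Q fun i hi => absurd hi (Nat.not_lt_zero _)).trans
      ((mono n le_rfl).trans hc.le)
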